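/- For any density matrices ρ and σ on ℂⁿ, the trace distance and fidelity satisfy D(ρ,σ) ≤ √(1 − F(ρ,σ)), where D(ρ,σ) = ½‖ρ − σ‖₁ and F(ρ,σ) = (Tr √(√ρ σ √ρ))². -/

import Mathlib

open Matrix Complex Finset
open scoped ComplexOrder

/-- The positive semidefinite square root of a positive semidefinite matrix -/
noncomputable def Matrix.PosSemidef.sqrt {n 𝕜 : Type*} [Fintype n] [RCLike 𝕜] [DecidableEq n]
    {A : Matrix n n 𝕜} (hA : A.PosSemidef) : Matrix n n 𝕜 :=
  hA.1.eigenvectorUnitary.1 * diagonal ((↑) ∘ Real.sqrt ∘ hA.1.eigenvalues) *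
  (star hA.1.eigenvectorUnitary : Matrix n n 𝕜)

lemma Matrix.PosSemidef.posSemidef_sqrt {n 𝕜 : Type*} [Fintype n] [RCLike 𝕜] [DecidableEq n]
    {A : Matrix n n 𝕜} (hA : A.PosSemidef) : hA.sqrt.PosSemidef := by
  apply PosSemidef.mul_mul_conjTranspose_same
  refine posSemidef_diagonal_iff.mpr fun i ↦ ?_
  rw [Function.comp_apply, RCLike.nonneg_iff]
  constructor
  · simp only [RCLike.ofReal_re]
    exact Real.sqrt_nonneg _
  · simp only [RCLike.ofReal_im]

/-- The trace norm `‖A‖₁ = Tr √(Aᴴ A)`. -/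
noncomputable def traceNorm {ι : Type*} [Fintype ι] [DecidableEq ι]
    (A : Matrix ι ι ℂ) : ℝ :=
  ((Matrix.posSemidef_conjTranspose_mul_self A).sqrt.trace).re

/-- The trace distance `D(ρ,σ) = ½‖ρ − σ‖₁`. -/
noncomputable def traceDist {ι : Type*} [Fintype ι] [DecidableEq ι]
    (ρ σ : Matrix ι ι ℂ) : ℝ :=
  traceNorm (ρ - σ) / 2

/-- The fidelity `F(ρ,σ) = (Tr √(√ρ σ √ρ))²`. -/
noncomputable def fidelity {n : ℕ} {ρ σ : Matrix (Fin n) (Fin n) ℂ}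
    (hρ : ρ.PosSemidef) (hσ : σ.PosSemidef) : ℝ :=
  (((show (hρ.sqrt * σ * hρ.sqrt).PosSemidef by
      simpa [hρ.posSemidef_sqrt.isHermitian.eq] using
        hσ.conjTranspose_mul_mul_same hρ.sqrt).sqrt.trace).re) ^ 2

lemma Matrix.PosSemidef.sqrt_mul_sqrt {n 𝕜 : Type*} [Fintype n] [RCLike 𝕜] [DecidableEq n]
    {A : Matrix n n 𝕜} (hA : A.PosSemidef) : hA.sqrt * hA.sqrt = A := by
  have hU : (star hA.1.eigenvectorUnitary : Matrix n n 𝕜) * hA.1.eigenvectorUnitary.1 = 1 :=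
    Unitary.coe_star_mul_self _
  have hd : diagonal ((↑) ∘ Real.sqrt ∘ hA.1.eigenvalues : n → 𝕜) *
      diagonal ((↑) ∘ Real.sqrt ∘ hA.1.eigenvalues : n → 𝕜) =
      diagonal ((↑) ∘ hA.1.eigenvalues) := by
    rw [diagonal_mul_diagonal]
    congr 1
    funext i
    simp only [Function.comp_apply]
    rw [← RCLike.ofReal_mul, Real.mul_self_sqrt (hA.eigenvalues_nonneg i)]
  conv_rhs => rw [hA.1.spectral_theorem, Unitary.conjStarAlgAut_apply, ← hd]
  unfold Matrix.PosSemidef.sqrt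
  simp only [Matrix.mul_assoc]
  rw [← Matrix.mul_assoc (star _ : Matrix n n 𝕜) hA.1.eigenvectorUnitary.1, hU, Matrix.one_mul]

/-- Polar decomposition, in the form of a partial isometry `W` with `Tr (Wᴴ M) = Tr √(Mᴴ M)`. -/
lemma exists_partialIsometry_trace_eq {ι : Type*} [Fintype ι] [DecidableEq ι]
    {M N : Matrix ι ι ℂ} (hN : N.PosSemidef) (h : Mᴴ * M = N) :
    ∃ W : Matrix ι ι ℂ, W * Wᴴ * W = W ∧ (Wᴴ * M).trace = hN.sqrt.trace := by
  set V : Matrix ι ι ℂ := hN.1.eigenvectorUnitary.1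
  set d : ι → ℝ := hN.1.eigenvalues
  have hVV : Vᴴ * V = 1 := Unitary.coe_star_mul_self _
  have hspec : N = V * diagonal (fun i => (d i : ℂ)) * Vᴴ := by
    conv_lhs => rw [hN.1.spectral_theorem, Unitary.conjStarAlgAut_apply]
    rfl
  have hsqrt : hN.sqrt = V * diagonal (fun i => (√(d i) : ℂ)) * Vᴴ := rfl
  set G : Matrix ι ι ℂ := diagonal (fun i => (((√(d i))⁻¹ : ℝ) : ℂ)) with hG
  have hGH : Gᴴ = G := by
    rw [hG, diagonal_conjTranspose]
    congr 1
    funext i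
    simp
  have hcancel : ∀ X : Matrix ι ι ℂ, Vᴴ * (V * X) = X := fun X => by
    rw [← Matrix.mul_assoc, hVV, Matrix.one_mul]
  have hGd : G * diagonal (fun i => (d i : ℂ)) = diagonal (fun i => (√(d i) : ℂ)) := by
    rw [hG, diagonal_mul_diagonal]
    congr 1
    funext i
    rw [← Complex.ofReal_mul, inv_mul_eq_div, Real.div_sqrt]
  have hGdGG : G * (diagonal (fun i => (√(d i) : ℂ)) * G) = G := by
    rw [hG, diagonal_mul_diagonal, diagonal_mul_diagonal]
    congr 1
    funext i
    rw [← Complex.ofReal_mul, ← Complex.ofReal_mul, ← mul_assoc]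
    simpa using congrArg Complex.ofReal (mul_inv_mul_cancel (√(d i))⁻¹)
  have hWH : (M * V * G * Vᴴ)ᴴ = V * G * Vᴴ * Mᴴ := by
    simp [conjTranspose_mul, hGH, Matrix.mul_assoc]
  have hWM : (M * V * G * Vᴴ)ᴴ * M = hN.sqrt := by
    rw [hWH, Matrix.mul_assoc, h, hsqrt, ← hGd]
    conv_lhs => rw [hspec]
    simp only [Matrix.mul_assoc, hcancel]
  refine ⟨M * V * G * Vᴴ, ?_, by rw [hWM]⟩
  calc M * V * G * Vᴴ * (M * V * G * Vᴴ)ᴴ * (M * V * G * Vᴴ)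
      = M * V * G * Vᴴ * ((M * V * G * Vᴴ)ᴴ * M) * V * G * Vᴴ := by
        simp only [Matrix.mul_assoc]
    _ = M * V * (G * (diagonal (fun i => (√(d i) : ℂ)) * G)) * Vᴴ := by
        rw [hWM, hsqrt]
        simp only [Matrix.mul_assoc, hcancel]
    _ = M * V * G * Vᴴ := by rw [hGdGG]

lemma re_trace_mul_conjTranspose_self_nonneg {ι κ : Type*} [Fintype ι] [Fintype κ]
    (C : Matrix ι κ ℂ) : 0 ≤ (C * Cᴴ).trace.re :=
  (Complex.nonneg_iff.mp (posSemidef_self_mul_conjTranspose C).trace_nonneg).1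

lemma re_trace_mul_conjTranspose_comm {ι κ : Type*} [Fintype ι] [Fintype κ]
    (C D : Matrix ι κ ℂ) : (D * Cᴴ).trace.re = (C * Dᴴ).trace.re := by
  have : (C * Dᴴ)ᴴ = D * Cᴴ := by simp
  rw [← this, trace_conjTranspose]
  simp

/-- Cauchy–Schwarz for the Hilbert–Schmidt inner product. -/
lemma re_trace_mul_conjTranspose_le {ι κ : Type*} [Fintype ι] [Fintype κ]
    (C D : Matrix ι κ ℂ) :
    (C * Dᴴ).trace.re ≤ √((C * Cᴴ).trace.re * (D * Dᴴ).trace.re) := by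
  apply Real.le_sqrt_of_sq_le
  have key : ∀ t : ℝ, 0 ≤ (D * Dᴴ).trace.re * (t * t) + (2 * (C * Dᴴ).trace.re) * t +
      (C * Cᴴ).trace.re := fun t => by
    have h := re_trace_mul_conjTranspose_self_nonneg (C + (t : ℂ) • D)
    have e : ((C + (t : ℂ) • D) * (C + (t : ℂ) • D)ᴴ).trace.re =
        (D * Dᴴ).trace.re * (t * t) + ((C * Dᴴ).trace.re + (D * Cᴴ).trace.re) * t +
        (C * Cᴴ).trace.re := by
      simp [conjTranspose_add, conjTranspose_smul, Matrix.add_mul, Matrix.mul_add]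
      ring
    rw [e, re_trace_mul_conjTranspose_comm C D] at h
    linarith
  have := discrim_le_zero key
  unfold discrim at this
  nlinarith

lemma one_sub_mul_conjTranspose_self {ι : Type*} [Fintype ι] [DecidableEq ι]
    {W : Matrix ι ι ℂ} (hW : W * Wᴴ * W = W) :
    (1 - W * Wᴴ) * (1 - W * Wᴴ)ᴴ = 1 - W * Wᴴ := by
  have : W * Wᴴ * (W * Wᴴ) = W * Wᴴ := by rw [← Matrix.mul_assoc, hW]
  simp [conjTranspose_sub, Matrix.sub_mul, Matrix.mul_sub, this]

/-- A partial isometry is a Hilbert–Schmidt contraction. -/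
lemma re_trace_partialIsometry_mul_le {ι κ : Type*} [Fintype ι] [DecidableEq ι] [Fintype κ]
    {W : Matrix ι ι ℂ} (hW : W * Wᴴ * W = W) (C : Matrix ι κ ℂ) :
    ((Wᴴ * C) * (Wᴴ * C)ᴴ).trace.re ≤ (C * Cᴴ).trace.re := by
  have h := re_trace_mul_conjTranspose_self_nonneg (Cᴴ * (1 - W * Wᴴ))
  have e : Cᴴ * (1 - W * Wᴴ) * (Cᴴ * (1 - W * Wᴴ))ᴴ = Cᴴ * C - Cᴴ * (W * (Wᴴ * C)) := by
    rw [conjTranspose_mul, Matrix.mul_assoc, ← Matrix.mul_assoc (1 - W * Wᴴ),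
      one_sub_mul_conjTranspose_self hW]
    simp [Matrix.sub_mul, Matrix.mul_sub, Matrix.mul_assoc]
  rw [e, trace_sub, Complex.sub_re] at h
  rw [trace_mul_comm (Wᴴ * C), trace_mul_comm C, conjTranspose_mul, conjTranspose_conjTranspose,
    Matrix.mul_assoc]
  linarith

lemma traceNorm_sub_le {ι κ : Type*} [Fintype ι] [DecidableEq ι] [Fintype κ]
    (X Y : Matrix ι κ ℂ) :
    traceNorm (X * Xᴴ - Y * Yᴴ) ≤
      √(((X - Y) * (X - Y)ᴴ).trace.re * ((X + Y) * (X + Y)ᴴ).trace.re) := by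
  obtain ⟨W, hW, hWtr⟩ := exists_partialIsometry_trace_eq
    (posSemidef_conjTranspose_mul_self (X * Xᴴ - Y * Yᴴ)) rfl
  have bound : ∀ C D : Matrix ι κ ℂ, (Wᴴ * C * Dᴴ).trace.re ≤
      √((C * Cᴴ).trace.re * (D * Dᴴ).trace.re) := fun C D =>
    (re_trace_mul_conjTranspose_le (Wᴴ * C) D).trans <| Real.sqrt_le_sqrt <|
      mul_le_mul_of_nonneg_right (re_trace_partialIsometry_mul_le hW C)
        (re_trace_mul_conjTranspose_self_nonneg D)
  have h₁ := bound (X - Y) (X + Y)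
  have h₂ := bound (X + Y) (X - Y)
  rw [mul_comm] at h₂
  have e : Wᴴ * (X - Y) * (X + Y)ᴴ + Wᴴ * (X + Y) * (X - Y)ᴴ =
      (2 : ℂ) • (Wᴴ * (X * Xᴴ - Y * Yᴴ)) := by
    rw [two_smul]
    simp only [conjTranspose_add, conjTranspose_sub, Matrix.mul_add, Matrix.mul_sub,
      Matrix.add_mul, Matrix.sub_mul, Matrix.mul_assoc]
    abel
  have e' := congrArg (fun A => (trace A).re) e
  simp only [trace_add, trace_smul, hWtr, Complex.add_re, smul_eq_mul, Complex.mul_re,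
    Complex.re_ofNat, Complex.im_ofNat, zero_mul, sub_zero] at e'
  unfold traceNorm
  linarith

/-- The purification argument: `X` and `Y` are vectorized purifications of two states with overlap
`Tr (X Yᴴ)`. -/
lemma traceDist_le_sqrt_one_sub_overlap {ι κ : Type*} [Fintype ι] [DecidableEq ι] [Fintype κ]
    (X Y : Matrix ι κ ℂ) (hX : (X * Xᴴ).trace = 1) (hY : (Y * Yᴴ).trace = 1) :
    traceDist (X * Xᴴ) (Y * Yᴴ) ≤ √(1 - (X * Yᴴ).trace.re ^ 2) := by
  have hYX := re_trace_mul_conjTranspose_comm X Y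
  have hsub : ((X - Y) * (X - Y)ᴴ).trace.re = 2 - 2 * (X * Yᴴ).trace.re := by
    simp [conjTranspose_sub, Matrix.sub_mul, Matrix.mul_sub, hX, hY, hYX]
    ring
  have hadd : ((X + Y) * (X + Y)ᴴ).trace.re = 2 + 2 * (X * Yᴴ).trace.re := by
    simp [conjTranspose_add, Matrix.add_mul, Matrix.mul_add, hX, hY, hYX]
    ring
  have h := traceNorm_sub_le X Y
  rw [hsub, hadd, show (2 - 2 * (X * Yᴴ).trace.re) * (2 + 2 * (X * Yᴴ).trace.re) =
    2 ^ 2 * (1 - (X * Yᴴ).trace.re ^ 2) by ring, Real.sqrt_mul (by norm_num),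
    Real.sqrt_sq (by norm_num)] at h
  unfold traceDist
  linarith

/-- `D(ρ,σ) ≤ √(1 − F(ρ,σ))`. -/
theorem traceDist_le_sqrt_one_sub_fidelity
    {n : ℕ} (ρ σ : Matrix (Fin n) (Fin n) ℂ)
    (hρ : ρ.PosSemidef) (hσ : σ.PosSemidef)
    (hτρ : ρ.trace = 1) (hτσ : σ.trace = 1) :
    traceDist ρ σ ≤ Real.sqrt (1 - fidelity hρ hσ) := by
  have hA := hρ.posSemidef_sqrt.isHermitian.eq
  have hB := hσ.posSemidef_sqrt.isHermitian.eq
  have hN : (hρ.sqrt * σ * hρ.sqrt).PosSemidef := by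
    simpa [hA] using hσ.conjTranspose_mul_mul_same hρ.sqrt
  obtain ⟨W, hW, hWtr⟩ := exists_partialIsometry_trace_eq (M := hσ.sqrt * hρ.sqrt) hN (by
    conv_rhs => rw [← hσ.sqrt_mul_sqrt]
    simp only [conjTranspose_mul, hA, hB, Matrix.mul_assoc])
  have hX : fromCols hρ.sqrt (0 : Matrix (Fin n) (Fin n) ℂ) *
      (fromCols hρ.sqrt (0 : Matrix (Fin n) (Fin n) ℂ))ᴴ = ρ := by
    simp [conjTranspose_fromCols_eq_fromRows_conjTranspose, fromCols_mul_fromRows, hA,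
      hρ.sqrt_mul_sqrt]
  have hY : fromCols (hσ.sqrt * W) (hσ.sqrt * (1 - W * Wᴴ)) *
      (fromCols (hσ.sqrt * W) (hσ.sqrt * (1 - W * Wᴴ)))ᴴ = σ := by
    rw [conjTranspose_fromCols_eq_fromRows_conjTranspose, fromCols_mul_fromRows]
    calc _ = hσ.sqrt * (W * Wᴴ + (1 - W * Wᴴ) * (1 - W * Wᴴ)ᴴ) * hσ.sqrt := by
          rw [conjTranspose_mul, conjTranspose_mul, hB]
          simp only [Matrix.mul_add, Matrix.add_mul, Matrix.mul_assoc]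
      _ = σ := by
          rw [one_sub_mul_conjTranspose_self hW, add_sub_cancel, Matrix.mul_one,
            hσ.sqrt_mul_sqrt]
  have hXY : (fromCols hρ.sqrt (0 : Matrix (Fin n) (Fin n) ℂ) *
      (fromCols (hσ.sqrt * W) (hσ.sqrt * (1 - W * Wᴴ)))ᴴ).trace = hN.sqrt.trace := by
    rw [← hWtr, conjTranspose_fromCols_eq_fromRows_conjTranspose, fromCols_mul_fromRows,
      Matrix.zero_mul, add_zero, trace_mul_comm, conjTranspose_mul, hB, Matrix.mul_assoc]
  have h := traceDist_le_sqrt_one_sub_overlap _ _ (hX ▸ hτρ) (hY ▸ hτσ)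
  rw [hX, hY, hXY] at h
  exact h
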